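/- For every s ≥ 0 and q ∈ ℤ with (s,q) ≠ (0,0), the Ext group Ext^{s,2q}_{MU_*MU}(MU_*, MU_*) of the Hopf algebroid (MU_*, MU_*MU) is a finite abelian group, and Ext^{0,0}_{MU_*MU}(MU_*, MU_*) ≅ ℤ. -/

import Mathlib

/-!
STATEMENT 7. `Ext^{s,2q}_{MU_*MU}(MU_*, MU_*)` is finite for `(s,q) ≠ (0,0)`,
and `Ext^{0,0} ≅ ℤ`.

Since `MU` is not available, the Hopf algebroid `(MU_*, MU_*MU)` is pinned down
by its functor of points: `Cb s` (the `s`-th term of its cobar complex,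
`Cb 0 = MU_*`, `Cb 1 = MU_*MU`) corepresents chains of `s` composable strict
isomorphisms of formal group laws; in particular `Cb 0` is the Lazard ring.
Formal group laws are encoded by their coefficient arrays, with associativity
expressed through the coefficients `Fpow F n i j` of powers of the series.
`Ext^{s,t}` is the cohomology of the cobar complex (alternating sum of the
cosimplicial coface maps) in internal degree `t`.
-/

open Finset

/-- Coefficient of `x^i y^j` in the `n`-th power of the two-variable formal
series with coefficients `F`. -/
def Fpow {R : Type*} [CommRing R] (F : ℕ → ℕ → R) : ℕ → ℕ → ℕ → R
  | 0, i, j => if i = 0 ∧ j = 0 then 1 else 0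
  | n + 1, i, j => ∑ p ∈ range (i + 1), ∑ q ∈ range (j + 1),
      F p q * Fpow F n (i - p) (j - q)

/-- Coefficient of `x^a` in the `n`-th power of the one-variable series `θ`. -/
def θpow {R : Type*} [CommRing R] (θ : ℕ → R) : ℕ → ℕ → R
  | 0, a => if a = 0 then 1 else 0
  | n + 1, a => ∑ p ∈ range (a + 1), θ p * θpow θ n (a - p)

/-- `F` is (the coefficient array of) a commutative formal group law. -/
structure IsFGL {R : Type*} [CommRing R] (F : ℕ → ℕ → R) : Prop where
  unit_left : ∀ j, F 0 j = if j = 1 then 1 else 0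
  unit_right : ∀ i, F i 0 = if i = 1 then 1 else 0
  comm : ∀ i j, F i j = F j i
  assoc : ∀ a b c, (∑ n ∈ range (a + b + 1), F n c * Fpow F n a b)
      = ∑ m ∈ range (b + c + 1), F a m * Fpow F m b c

/-- `θ` is the coefficient array of a strict power series isomorphism. -/
def IsStrictIso {R : Type*} [CommRing R] (θ : ℕ → R) : Prop :=
  θ 0 = 0 ∧ θ 1 = 1

/-- `G'` is the image of the formal group law `G` under the strict isomorphism
`θ`, i.e. `θ(G(x,y)) = G'(θ x, θ y)`, coefficientwise. -/
def IsTargetOf {R : Type*} [CommRing R] (G : ℕ → ℕ → R) (θ : ℕ → R)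
    (G' : ℕ → ℕ → R) : Prop :=
  ∀ a b, (∑ n ∈ range (a + b + 1), θ n * Fpow G n a b)
    = ∑ n ∈ range (a + 1), ∑ m ∈ range (b + 1), G' n m * θpow θ n a * θpow θ m b

/-- Coefficients of the composite `θ₂ ∘ θ₁` of strict isomorphisms. -/
def compθ {R : Type*} [CommRing R] (θ₂ θ₁ : ℕ → R) (n : ℕ) : R :=
  ∑ m ∈ range (n + 1), θ₂ m * θpow θ₁ m n

/-- The cobar differential: alternating sum of the coface maps. -/
noncomputable def cobarDiff (Cb : ℕ → Type*) [∀ s, CommRing (Cb s)]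
    (coface : ∀ s : ℕ, ℕ → (Cb s →+* Cb (s + 1))) (s : ℕ) : Cb s →+ Cb (s + 1) :=
  ∑ i ∈ range (s + 2), ((-1 : ℤ) ^ i) • (coface s i).toAddMonoidHom

/-- `Ext^{s,t}`: cohomology of the cobar complex in internal degree `t`. -/
@[reducible] noncomputable def cobarExt (Cb : ℕ → Type*) [∀ s, CommRing (Cb s)]
    (coface : ∀ s : ℕ, ℕ → (Cb s →+* Cb (s + 1)))
    (gr : ∀ s : ℕ, ℤ → AddSubgroup (Cb s)) (s : ℕ) (t : ℤ) : Type _ :=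
  let Z : AddSubgroup (Cb s) := (cobarDiff Cb coface s).ker ⊓ gr s t
  let B : AddSubgroup (Cb s) :=
    match s with
    | 0 => ⊥
    | s' + 1 => (cobarDiff Cb coface s').range
  Z ⧸ ((B ⊓ Z).addSubgroupOf Z)

section Naturality

variable {R S : Type*} [CommRing R] [CommRing S] (f : R →+* S)

theorem Fpow_map (F : ℕ → ℕ → R) (n i j : ℕ) :
    f (Fpow F n i j) = Fpow (fun i j => f (F i j)) n i j := by
  induction n generalizing i j with
  | zero => simp [Fpow, apply_ite f]
  | succ n ih => simp [Fpow, ih]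

theorem θpow_map (θ : ℕ → R) (n a : ℕ) :
    f (θpow θ n a) = θpow (fun i => f (θ i)) n a := by
  induction n generalizing a with
  | zero => simp [θpow, apply_ite f]
  | succ n ih => simp [θpow, ih]

theorem compθ_map (θ₂ θ₁ : ℕ → R) (n : ℕ) :
    f (compθ θ₂ θ₁ n) = compθ (fun i => f (θ₂ i)) (fun i => f (θ₁ i)) n := by
  simp [compθ, θpow_map]

variable {f}

theorem IsFGL.map {F : ℕ → ℕ → R} (hF : IsFGL F) (f : R →+* S) :
    IsFGL (fun i j => f (F i j)) where
  unit_left j := by simp [hF.unit_left, apply_ite f]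
  unit_right j := by simp [hF.unit_right, apply_ite f]
  comm i j := by rw [hF.comm]
  assoc a b c := by simpa [Fpow_map] using congrArg f (hF.assoc a b c)

theorem IsStrictIso.map {θ : ℕ → R} (h : IsStrictIso θ) (f : R →+* S) :
    IsStrictIso (fun i => f (θ i)) := by
  simp [IsStrictIso, h.1, h.2]

theorem IsTargetOf.map {G G' : ℕ → ℕ → R} {θ : ℕ → R} (h : IsTargetOf G θ G') (f : R →+* S) :
    IsTargetOf (fun i j => f (G i j)) (fun i => f (θ i)) (fun i j => f (G' i j)) := fun a b => by
  simpa [Fpow_map, θpow_map] using congrArg f (h a b)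

end Naturality

/-- The coefficient array of the additive formal group law. -/
def additiveFGL (R : Type*) [CommRing R] (i j : ℕ) : R := if i + j = 1 then 1 else 0

section Bivariate

open PowerSeries

variable {R : Type*} [CommRing R]

/-- The two-variable series with coefficient array `F`, as a series in `y` over `R⟦x⟧`. -/
noncomputable def bivariate (F : ℕ → ℕ → R) : R⟦X⟧⟦X⟧ :=
  PowerSeries.mk fun b => PowerSeries.mk fun a => F a b

@[simp]
theorem coeff_coeff_bivariate (F : ℕ → ℕ → R) (a b : ℕ) :
    coeff a (coeff b (bivariate F)) = F a b := by
  simp [bivariate]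

theorem coeff_coeff_mul (f g : R⟦X⟧⟦X⟧) (a b : ℕ) :
    coeff a (coeff b (f * g)) = ∑ q ∈ antidiagonal b, ∑ p ∈ antidiagonal a,
      coeff p.1 (coeff q.1 f) * coeff p.2 (coeff q.2 g) := by
  simp [coeff_mul]

theorem Fpow_eq_coeff (F : ℕ → ℕ → R) (n a b : ℕ) :
    Fpow F n a b = coeff a (coeff b (bivariate F ^ n)) := by
  induction n generalizing a b with
  | zero =>
    simp only [Fpow, pow_zero, coeff_one]
    by_cases hb : b = 0 <;> by_cases ha : a = 0 <;> simp [hb, ha, coeff_one]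
  | succ n ih =>
    rw [pow_succ', coeff_coeff_mul, Fpow, sum_comm,
      Nat.sum_antidiagonal_eq_sum_range_succ_mk]
    refine sum_congr rfl fun q _ => ?_
    rw [Nat.sum_antidiagonal_eq_sum_range_succ_mk]
    simp [ih]

theorem Fpow_eq_zero {F : ℕ → ℕ → R} (hF : F 0 0 = 0) {n a b : ℕ} (h : a + b < n) :
    Fpow F n a b = 0 := by
  induction n generalizing a b with
  | zero => omega
  | succ n ih =>
    refine sum_eq_zero fun p hp => sum_eq_zero fun q hq => ?_
    rw [mem_range] at hp hq
    rcases Nat.eq_zero_or_pos (p + q) with h0 | h0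
    · obtain ⟨rfl, rfl⟩ : p = 0 ∧ q = 0 := by omega
      rw [hF, zero_mul]
    · rw [ih (by omega), mul_zero]

/-- The composite of a one-variable series `c` with the two-variable series `F`. -/
noncomputable def compBivariate (c : R⟦X⟧) (F : ℕ → ℕ → R) : R⟦X⟧⟦X⟧ :=
  PowerSeries.mk fun b => PowerSeries.mk fun a =>
    ∑ n ∈ range (a + b + 1), coeff n c * Fpow F n a b

theorem coeff_coeff_compBivariate (c : R⟦X⟧) (F : ℕ → ℕ → R) (a b : ℕ) :
    coeff a (coeff b (compBivariate c F)) =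
      ∑ n ∈ range (a + b + 1), coeff n c * Fpow F n a b := by
  simp [compBivariate]

theorem coeff_coeff_eval₂ {F : ℕ → ℕ → R} (hF : F 0 0 = 0) (p : Polynomial R) (a b : ℕ) :
    coeff a (coeff b (p.eval₂ ((C (R := R⟦X⟧)).comp C) (bivariate F))) =
      ∑ n ∈ range (a + b + 1), p.coeff n * Fpow F n a b := by
  rw [Polynomial.eval₂_eq_sum_range' _
    (Nat.lt_of_lt_of_le (Nat.lt_succ_self _) (le_max_left _ (a + b + 1)))]
  simp only [map_sum, RingHom.comp_apply, coeff_C_mul, ← Fpow_eq_coeff]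
  symm
  refine sum_subset (range_mono (le_max_right _ _)) fun n _ hn => ?_
  rw [mem_range, not_lt] at hn
  rw [Fpow_eq_zero hF (by omega), mul_zero]

theorem coeff_coeff_eval₂_trunc {F : ℕ → ℕ → R} (hF : F 0 0 = 0) (c : R⟦X⟧) {a b N : ℕ}
    (h : a + b < N) :
    coeff a (coeff b ((trunc N c).eval₂ ((C (R := R⟦X⟧)).comp C) (bivariate F))) =
      coeff a (coeff b (compBivariate c F)) := by
  rw [coeff_coeff_eval₂ hF, coeff_coeff_compBivariate]
  refine sum_congr rfl fun n hn => ?_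
  rw [mem_range] at hn
  rw [coeff_trunc, if_pos (by omega)]

theorem coeff_coeff_mul_congr {f f' g g' : R⟦X⟧⟦X⟧} {a b : ℕ}
    (hf : ∀ i ≤ a, ∀ j ≤ b, coeff i (coeff j f) = coeff i (coeff j f'))
    (hg : ∀ i ≤ a, ∀ j ≤ b, coeff i (coeff j g) = coeff i (coeff j g')) :
    coeff a (coeff b (f * g)) = coeff a (coeff b (f' * g')) := by
  rw [coeff_coeff_mul, coeff_coeff_mul]
  refine sum_congr rfl fun q hq => sum_congr rfl fun p hp => ?_
  rw [HasAntidiagonal.mem_antidiagonal] at hp hq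
  rw [hf _ (by omega) _ (by omega), hg _ (by omega) _ (by omega)]

theorem compBivariate_mul {F : ℕ → ℕ → R} (hF : F 0 0 = 0) (c d : R⟦X⟧) :
    compBivariate (c * d) F = compBivariate c F * compBivariate d F := by
  ext b a
  have key := coeff_coeff_mul_congr (a := a) (b := b)
    (fun i hi j hj => (coeff_coeff_eval₂_trunc hF c (N := a + b + 1) (a := i) (b := j) (by omega)))
    (fun i hi j hj => (coeff_coeff_eval₂_trunc hF d (N := a + b + 1) (a := i) (b := j) (by omega)))
  rw [← key, ← Polynomial.eval₂_mul, coeff_coeff_eval₂ hF, coeff_coeff_compBivariate]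
  refine sum_congr rfl fun n hn => ?_
  rw [coeff_mul_eq_coeff_trunc_mul_trunc c d (mem_range.mp hn), ← Polynomial.coe_mul,
    Polynomial.coeff_coe]

theorem compBivariate_one (F : ℕ → ℕ → R) : compBivariate 1 F = 1 := by
  ext b a
  rw [coeff_coeff_compBivariate, sum_range_succ']
  have := Fpow_eq_coeff F 0 a b
  simp_all [coeff_one]

end Bivariate

section Logarithm

open PowerSeries

variable {R : Type*} [CommRing R]

/-- The series `∂G/∂y (x, 0)`, the inverse of the invariant differential of `G`. -/
noncomputable def tangentSeries (G : ℕ → ℕ → R) : R⟦X⟧ := PowerSeries.mk fun n => G n 1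

theorem derivative_C_mul (c : R) (f : R⟦X⟧) :
    derivative R (C c * f) = C c * derivative R f := by
  ext n
  simp [coeff_derivative]

namespace IsFGL

variable {G : ℕ → ℕ → R} (hG : IsFGL G)

include hG

theorem Fpow_coeff_one (n b : ℕ) :
    Fpow G (n + 1) b 1 = coeff b ((n + 1 : R⟦X⟧) * X ^ n * tangentSeries G) := by
  have h0 : constantCoeff (bivariate G) = X := by
    ext i
    rw [← coeff_zero_eq_constantCoeff_apply, coeff_coeff_bivariate, hG.unit_right, coeff_X]
  have h1 : coeff 1 (bivariate G) = tangentSeries G := by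
    ext i
    simp [tangentSeries]
  rw [Fpow_eq_coeff, coeff_one_pow, h0, h1]
  congr 1
  push_cast
  ring

theorem sum_Fpow_coeff_one (c : ℕ → R) (b : ℕ) :
    ∑ n ∈ range (b + 2), c n * Fpow G n b 1 =
      ∑ p ∈ antidiagonal b, c (p.1 + 1) * (p.1 + 1) * G p.2 1 := by
  rw [sum_range_succ', Nat.sum_antidiagonal_eq_sum_range_succ_mk]
  rw [show Fpow G 0 b 1 = 0 by simp [Fpow], mul_zero, add_zero]
  refine sum_congr rfl fun k hk => ?_
  rw [hG.Fpow_coeff_one, mul_assoc, ← Nat.cast_succ, ← map_natCast (C (R := R)), coeff_C_mul,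
    coeff_X_pow_mul', if_pos (by simpa [Nat.lt_succ_iff] using hk)]
  simp [tangentSeries, mul_assoc]

theorem compBivariate_tangentSeries :
    compBivariate (tangentSeries G) G =
      derivative (R⟦X⟧) (bivariate G) * PowerSeries.map C (tangentSeries G) := by
  ext b a
  have h := hG.assoc a b 1
  rw [hG.sum_Fpow_coeff_one] at h
  rw [coeff_coeff_compBivariate, coeff_mul, map_sum]
  simp only [tangentSeries, coeff_mk, coeff_map, coeff_mul_C, coeff_derivative]
  rw [h]
  refine sum_congr rfl fun p _ => ?_
  have hcast : ((p.1 : R⟦X⟧) + 1) = C ((p.1 : R) + 1) := by simp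
  rw [hcast, coeff_mul_C, coeff_coeff_bivariate]

theorem compBivariate_mul_derivative {U : R⟦X⟧} (hU : tangentSeries G * U = 1) :
    compBivariate U G * derivative (R⟦X⟧) (bivariate G) = PowerSeries.map C U := by
  have h00 : G 0 0 = 0 := by simp [hG.unit_left]
  calc _ = compBivariate U G * derivative (R⟦X⟧) (bivariate G) *
        PowerSeries.map C (tangentSeries G * U) := by rw [hU, map_one, mul_one]
    _ = compBivariate (U * tangentSeries G) G * PowerSeries.map C U := by
        rw [compBivariate_mul h00, hG.compBivariate_tangentSeries, map_mul]; ring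
    _ = _ := by rw [mul_comm U, hU, compBivariate_one, one_mul]

theorem constantCoeff_tangentSeries : constantCoeff (tangentSeries G) = 1 := by
  rw [← coeff_zero_eq_constantCoeff_apply]
  simp [tangentSeries, hG.unit_left]

theorem succ_mul_sum_Fpow {U : R⟦X⟧} (hU : tangentSeries G * U = 1) {l : ℕ → R}
    (hl : ∀ n : ℕ, l (n + 1) * (n + 1) = coeff n U) (a b : ℕ) :
    (∑ n ∈ range (a + (b + 1) + 1), l n * Fpow G n a (b + 1)) * (b + 1) =
      if a = 0 then coeff b U else 0 := by
  have h00 : G 0 0 = 0 := by simp [hG.unit_left]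
  set D := derivative (R⟦X⟧) (bivariate G) with hD
  have hcoeff : coeff a (coeff b (PowerSeries.map C U)) = if a = 0 then coeff b U else 0 := by
    rw [coeff_map, coeff_C]
  rw [← hcoeff, ← hG.compBivariate_mul_derivative hU]
  have hcongr := coeff_coeff_mul_congr (a := a) (b := b) (g := D) (g' := D)
    (fun i hi j hj => (coeff_coeff_eval₂_trunc h00 U (N := a + b + 1) (a := i) (b := j) (by omega)))
    (fun _ _ _ _ => rfl)
  rw [← hcongr, Polynomial.eval₂_eq_sum_range' _ (n := a + b + 1)
    (natDegree_trunc_lt U (a + b))]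
  have hsum : derivative (R⟦X⟧)
      (∑ n ∈ range (a + b + 2), C (C (l n)) * bivariate G ^ n) =
      (∑ n ∈ range (a + b + 1), C (C (coeff n U)) * bivariate G ^ n) * D := by
    rw [sum_range_succ', map_add, map_sum, sum_mul]
    simp only [pow_zero, mul_one, derivative_C, add_zero]
    refine sum_congr rfl fun n _ => ?_
    rw [derivative_C_mul, derivative_pow, ← hl]
    simp only [Nat.add_sub_cancel, map_mul, map_add, map_natCast, map_one,
      Nat.cast_add, Nat.cast_one]
    ring
  have htr : ∑ n ∈ range (a + b + 1), ((C (R := R⟦X⟧)).comp C) ((trunc (a + b + 1) U).coeff n) *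
      bivariate G ^ n = ∑ n ∈ range (a + b + 1), C (C (coeff n U)) * bivariate G ^ n := by
    refine sum_congr rfl fun n hn => ?_
    rw [coeff_trunc, if_pos (mem_range.mp hn)]
    rfl
  rw [htr, ← hsum, coeff_derivative, ← Nat.cast_succ, ← Nat.cast_succ,
    ← map_natCast (C (R := R)) (b + 1), coeff_mul_C]
  simp only [map_sum, coeff_C_mul, ← Fpow_eq_coeff]
  rfl

theorem Fpow_coeff_zero (n a : ℕ) : Fpow G n a 0 = if a = n then 1 else 0 := by
  have h0 : constantCoeff (bivariate G) = X := by
    ext i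
    rw [← coeff_zero_eq_constantCoeff_apply, coeff_coeff_bivariate, hG.unit_right, coeff_X]
  rw [Fpow_eq_coeff, coeff_zero_eq_constantCoeff_apply, map_pow, h0, coeff_X_pow]

end IsFGL

theorem θpow_zero (l : ℕ → R) (a : ℕ) : θpow l 0 a = if a = 0 then 1 else 0 := rfl

theorem θpow_one (l : ℕ → R) (a : ℕ) : θpow l 1 a = l a := by
  rw [θpow, sum_range_succ, sum_eq_zero]
  · simp [θpow]
  · intro p hp
    rw [mem_range] at hp
    rw [θpow, if_neg (by omega), mul_zero]

theorem sum_additiveFGL {l : ℕ → R} (hl : l 0 = 0) (a b : ℕ) :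
    ∑ n ∈ range (a + 1), ∑ m ∈ range (b + 1), additiveFGL R n m * θpow l n a * θpow l m b =
      (if b = 0 then l a else 0) + if a = 0 then l b else 0 := by
  have h : ∀ n m, additiveFGL R n m * θpow l n a * θpow l m b =
      (if n = 1 then if m = 0 then (if b = 0 then l a else 0) else 0 else 0) +
      (if n = 0 then if m = 1 then (if a = 0 then l b else 0) else 0 else 0) := by
    intro n m
    by_cases hnm : n + m = 1
    · obtain ⟨rfl, rfl⟩ | ⟨rfl, rfl⟩ : n = 1 ∧ m = 0 ∨ n = 0 ∧ m = 1 := by omega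
      · simp [additiveFGL, θpow_one, θpow_zero]
      · simp [additiveFGL, θpow_one, θpow_zero]
    · rw [additiveFGL, if_neg hnm]
      split_ifs <;> first | omega | simp
  simp only [h, sum_add_distrib, sum_ite_irrel, sum_ite_eq', mem_range, sum_const_zero]
  rcases a with _ | a <;> rcases b with _ | b <;> simp [hl]

theorem isTargetOf_additiveFGL_iff {G : ℕ → ℕ → R} {l : ℕ → R} (hl : l 0 = 0) :
    IsTargetOf G l (additiveFGL R) ↔ ∀ a b, ∑ n ∈ range (a + b + 1), l n * Fpow G n a b =
      (if b = 0 then l a else 0) + if a = 0 then l b else 0 := by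
  simp only [IsTargetOf, sum_additiveFGL hl]

/-- Over a ring in which positive integers are invertible, a formal group law has a logarithm. -/
theorem IsFGL.exists_log (hR : ∀ n : ℕ, IsUnit (n + 1 : R)) {G : ℕ → ℕ → R} (hG : IsFGL G) :
    ∃ l, IsStrictIso l ∧ IsTargetOf G l (additiveFGL R) := by
  obtain ⟨U, hU⟩ : ∃ U, tangentSeries G * U = 1 :=
    ⟨_, mul_invOfUnit _ 1 (by simpa using hG.constantCoeff_tangentSeries)⟩
  let l : ℕ → R := fun n => n.casesOn 0 fun k => coeff k U * Ring.inverse (k + 1 : R)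
  have hl (n : ℕ) : l (n + 1) * (n + 1) = coeff n U := by
    change coeff n U * Ring.inverse (n + 1 : R) * (n + 1) = _
    rw [mul_assoc, Ring.inverse_mul_cancel _ (hR n), mul_one]
  have hU0 : coeff 0 U = 1 := by
    have := congrArg (constantCoeff (R := R)) hU
    rw [map_mul, hG.constantCoeff_tangentSeries, one_mul, map_one] at this
    simpa using this
  refine ⟨l, ⟨rfl, by simpa [hU0] using hl 0⟩, (isTargetOf_additiveFGL_iff rfl).2 fun a b => ?_⟩
  cases b with
  | zero =>
    simp only [hG.Fpow_coeff_zero]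
    simp [l]
  | succ b =>
    apply (hR b).mul_left_injective
    change (_ : R) * (b + 1) = _ * (b + 1)
    rw [hG.succ_mul_sum_Fpow hU hl]
    simp [hl, ite_mul]

/-- Over a ring in which positive integers are invertible, logarithms are unique. -/
theorem IsFGL.log_unique (hR : ∀ n : ℕ, IsUnit (n + 1 : R)) {G : ℕ → ℕ → R} (hG : IsFGL G)
    {l l' : ℕ → R} (hl : IsStrictIso l) (hlG : IsTargetOf G l (additiveFGL R))
    (hl' : IsStrictIso l') (hlG' : IsTargetOf G l' (additiveFGL R)) : l = l' := by
  have key : ∀ {l : ℕ → R}, IsStrictIso l → IsTargetOf G l (additiveFGL R) →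
      (PowerSeries.mk fun n => l (n + 1) * (n + 1)) * tangentSeries G = 1 := by
    intro l hl h
    ext a
    have := (isTargetOf_additiveFGL_iff hl.1).1 h a 1
    rw [hG.sum_Fpow_coeff_one] at this
    simp [coeff_mul, coeff_one, tangentSeries, this, hl.2]
  have heq := left_inv_eq_right_inv (key hl hlG) ((mul_comm _ _).trans (key hl' hlG'))
  funext n
  cases n with
  | zero => rw [hl.1, hl'.1]
  | succ n =>
    apply (hR n).mul_left_injective
    simpa using congrArg (coeff n) heq

theorem sum_additiveFGL_mul (c k : ℕ) (x : ℕ → R) :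
    ∑ n ∈ range (k + 1), additiveFGL R n c * x n =
      (if c = 0 then if 1 ≤ k then x 1 else 0 else 0) + if c = 1 then x 0 else 0 := by
  have h : ∀ n, additiveFGL R n c * x n =
      (if n = 1 then if c = 0 then x 1 else 0 else 0) +
      (if n = 0 then if c = 1 then x 0 else 0 else 0) := by
    intro n
    by_cases hn : n + c = 1
    · obtain ⟨rfl, rfl⟩ | ⟨rfl, rfl⟩ : n = 1 ∧ c = 0 ∨ n = 0 ∧ c = 1 := by omega
      · simp [additiveFGL]
      · simp [additiveFGL]
    · rw [additiveFGL, if_neg hn]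
      split_ifs <;> first | omega | simp
  simp only [h, sum_add_distrib, sum_ite_eq', mem_range]
  split_ifs <;> first | omega | simp

theorem Fpow_one (F : ℕ → ℕ → R) (a b : ℕ) : Fpow F 1 a b = F a b := by
  rw [Fpow_eq_coeff, pow_one, coeff_coeff_bivariate]

theorem additiveFGL_comm (i j : ℕ) : additiveFGL R i j = additiveFGL R j i := by
  rw [additiveFGL, additiveFGL, add_comm]

theorem isFGL_additiveFGL : IsFGL (additiveFGL R) where
  unit_left j := by simp [additiveFGL]
  unit_right i := by simp [additiveFGL]
  comm := additiveFGL_comm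
  assoc a b c := by
    simp only [additiveFGL_comm a]
    rw [sum_additiveFGL_mul, sum_additiveFGL_mul, Fpow_one, Fpow_one]
    simp only [Fpow, additiveFGL]
    split_ifs <;> first | omega | simp

theorem map_additiveFGL {S : Type*} [CommRing S] (f : R →+* S) (i j : ℕ) :
    f (additiveFGL R i j) = additiveFGL S i j := by
  simp [additiveFGL, apply_ite f]

end Logarithm

section Generators

variable {A : Type*} [CommRing A]

/-- Monomials of weight `n` in generators of positive weight. -/
inductive IsMonomial (gens : ℕ → Set A) : ℕ → A → Prop
  | one : IsMonomial gens 0 1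
  | mul {e n : ℕ} {g m : A} (he : 0 < e) (hg : g ∈ gens e) (hm : IsMonomial gens n m) :
      IsMonomial gens (n + e) (g * m)

namespace IsMonomial

variable {gens : ℕ → Set A}

theorem mul_mul {n k : ℕ} {x y : A} (hx : IsMonomial gens n x) (hy : IsMonomial gens k y) :
    IsMonomial gens (n + k) (x * y) := by
  induction hx with
  | one => simpa using hy
  | mul he hg _ ih => rw [add_right_comm, mul_assoc]; exact ih.mul he hg

theorem finite (hfin : ∀ e, (gens e).Finite) (n : ℕ) : {m | IsMonomial gens n m}.Finite := by
  induction n using Nat.strong_induction_on with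
  | _ n ih =>
    refine ((Set.finite_singleton (1 : A)).union ((Set.finite_Icc 1 n).biUnion'
      (t := fun e he => Set.image2 (· * ·) (gens e) {m | IsMonomial gens (n - e) m})
      fun e he => (hfin e).image2 _ (ih _ ?_))).subset ?_
    · rw [Set.mem_Icc] at he
      omega
    · rintro m hm
      cases hm with
      | one => exact Or.inl rfl
      | @mul e k g m he hg hm =>
        refine Or.inr (Set.mem_iUnion₂.2 ⟨e, ⟨he, by omega⟩, g, hg, m, ?_, rfl⟩)
        simpa using hm

theorem eq_one {x : A} (hx : IsMonomial gens 0 x) : x = 1 := by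
  generalize hn : 0 = n at hx
  cases hx with
  | one => rfl
  | mul he => omega

theorem map_eq_zero {B : Type*} [CommRing B] {f : A →+* B}
    (hf : ∀ e, 0 < e → ∀ x ∈ gens e, f x = 0) {n : ℕ} {x : A} (hx : IsMonomial gens n x)
    (hn : n ≠ 0) : f x = 0 := by
  cases hx with
  | one => exact absurd rfl hn
  | mul he hg => rw [map_mul, hf _ he _ hg, zero_mul]

theorem mem_grading {𝒜 : ℤ → AddSubgroup A} (h1 : (1 : A) ∈ 𝒜 0)
    (hmul : ∀ t t' : ℤ, ∀ x ∈ 𝒜 t, ∀ y ∈ 𝒜 t', x * y ∈ 𝒜 (t + t'))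
    (hgens : ∀ (e : ℕ), ∀ x ∈ gens e, x ∈ 𝒜 (2 * (e : ℤ))) {n : ℕ} {x : A}
    (hx : IsMonomial gens n x) : x ∈ 𝒜 (2 * (n : ℤ)) := by
  induction hx with
  | one => simpa using h1
  | @mul e n g m he hg _ ih =>
    have := hmul _ _ _ (hgens _ _ hg) _ ih
    rwa [← mul_add, add_comm, ← Nat.cast_add] at this

theorem mem_closure {x : A} (hx : x ∈ Subring.closure {g | ∃ e > 0, g ∈ gens e}) :
    x ∈ AddSubgroup.closure {m | ∃ n, IsMonomial gens n m} := by
  rw [Subring.mem_closure_iff] at hx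
  refine AddSubgroup.closure_mono (fun y hy => ?_) hx
  induction hy using Submonoid.closure_induction with
  | mem g hg =>
    obtain ⟨e, he, hg⟩ := hg
    exact ⟨0 + e, by simpa using one.mul he hg⟩
  | one => exact ⟨0, one⟩
  | mul x y _ _ hx hy =>
    obtain ⟨n, hn⟩ := hx
    obtain ⟨k, hk⟩ := hy
    exact ⟨n + k, hn.mul_mul hk⟩

theorem grading_le_closure {𝒜 : ℤ → AddSubgroup A} (h𝒜 : DirectSum.IsInternal 𝒜)
    (h1 : (1 : A) ∈ 𝒜 0) (hmul : ∀ t t' : ℤ, ∀ x ∈ 𝒜 t, ∀ y ∈ 𝒜 t', x * y ∈ 𝒜 (t + t'))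
    (hgens : ∀ (e : ℕ), ∀ x ∈ gens e, x ∈ 𝒜 (2 * (e : ℤ)))
    (htop : Subring.closure {g | ∃ e > 0, g ∈ gens e} = ⊤) (t : ℤ) :
    𝒜 t ≤ AddSubgroup.closure {m | ∃ n : ℕ, IsMonomial gens n m ∧ 2 * (n : ℤ) = t} := by
  let := h𝒜.chooseDecomposition
  have key : ∀ x, (DirectSum.decompose 𝒜 x t : A) ∈
      AddSubgroup.closure {m | ∃ n : ℕ, IsMonomial gens n m ∧ 2 * (n : ℤ) = t} := by
    intro x
    have hx : x ∈ AddSubgroup.closure {m | ∃ n, IsMonomial gens n m} :=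
      mem_closure (htop ▸ Subring.mem_top x)
    induction hx using AddSubgroup.closure_induction with
    | mem m hm =>
      obtain ⟨n, hn⟩ := hm
      have hmem := hn.mem_grading h1 hmul hgens
      by_cases hnt : 2 * (n : ℤ) = t
      · rw [← hnt, DirectSum.decompose_of_mem_same _ hmem, hnt]
        exact AddSubgroup.subset_closure ⟨n, hn, hnt⟩
      · rw [DirectSum.decompose_of_mem_ne _ hmem hnt]
        exact zero_mem _
    | zero => simp
    | add x y _ _ hx hy =>
      rw [DirectSum.decompose_add]
      exact add_mem hx hy
    | neg x _ hx =>
      rw [DirectSum.decompose_neg]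
      exact neg_mem hx
  intro x hx
  simpa [DirectSum.decompose_of_mem_same _ hx] using key x

theorem finite_of_two_mul (hfin : ∀ e, (gens e).Finite) (t : ℤ) :
    {m | ∃ n : ℕ, IsMonomial gens n m ∧ 2 * (n : ℤ) = t}.Finite := by
  refine (finite hfin (t / 2).toNat).subset ?_
  rintro m ⟨n, hn, rfl⟩
  simpa using hn

end IsMonomial

theorem finite_quotient_of_torsion {Z : AddSubgroup A} {K : AddSubgroup Z} {s : Set A}
    (hs : s.Finite) (hZ : Z ≤ AddSubgroup.closure s)
    (h : ∀ z : Z, ∃ n : ℕ, 0 < n ∧ n • z ∈ K) : Finite (Z ⧸ K) := by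
  have := isNoetherian_span_of_finite ℤ hs
  have hle : AddSubgroup.toIntSubmodule Z ≤ Submodule.span ℤ s := by
    intro x hx
    rw [← Submodule.mem_toAddSubgroup, Submodule.span_int_eq_addSubgroupClosure]
    exact hZ hx
  have : IsNoetherian ℤ (AddSubgroup.toIntSubmodule Z) := isNoetherian_of_le hle
  have : Module.Finite ℤ Z := inferInstanceAs (Module.Finite ℤ (AddSubgroup.toIntSubmodule Z))
  have : AddGroup.FG Z := Module.Finite.iff_addGroup_fg.1 inferInstance
  refine AddCommGroup.finite_of_fg_isAddTorsion _ fun x => ?_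
  obtain ⟨z, rfl⟩ := QuotientAddGroup.mk_surjective x
  obtain ⟨n, hn, hnz⟩ := h z
  refine isOfFinAddOrder_iff_nsmul_eq_zero.2 ⟨n, hn, ?_⟩
  rw [← QuotientAddGroup.mk_nsmul]
  exact (QuotientAddGroup.eq_zero_iff _).2 hnz

end Generators

section Rationalization

/-- The submonoid of images of positive integers. -/
def natSubmonoid (A : Type*) [CommRing A] : Submonoid A :=
  Submonoid.map (Nat.castRingHom A) (nonZeroDivisors ℕ)

/-- The ring `A ⊗ ℚ`. -/
abbrev Rationalization (A : Type*) [CommRing A] : Type _ := Localization (natSubmonoid A)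

namespace Rationalization

variable {A B : Type*} [CommRing A] [CommRing B]

theorem mem_natSubmonoid {x : A} : x ∈ natSubmonoid A ↔ ∃ n : ℕ, 0 < n ∧ (n : A) = x := by
  simp [natSubmonoid, Submonoid.mem_map, Nat.pos_iff_ne_zero]

theorem isUnit_natCast_succ (n : ℕ) : IsUnit (n + 1 : Rationalization A) := by
  have := IsLocalization.map_units (Rationalization A)
    (⟨((n + 1 : ℕ) : A), mem_natSubmonoid.2 ⟨n + 1, n.succ_pos, rfl⟩⟩ : natSubmonoid A)
  simpa using this

/-- The ring homomorphism `f ⊗ ℚ`. -/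
noncomputable def map (f : A →+* B) : Rationalization A →+* Rationalization B :=
  IsLocalization.map (M := natSubmonoid A) (T := natSubmonoid B) (Rationalization B) f (by
    intro x hx
    obtain ⟨n, hn, rfl⟩ := mem_natSubmonoid.1 hx
    exact mem_natSubmonoid.2 ⟨n, hn, by simp⟩)

theorem map_algebraMap (f : A →+* B) (x : A) :
    map f (algebraMap A _ x) = algebraMap B _ (f x) :=
  IsLocalization.map_eq _ x

theorem exists_nsmul_eq (x : Rationalization A) :
    ∃ (n : ℕ) (a : A), 0 < n ∧ n • x = algebraMap A _ a := by
  obtain ⟨⟨a, m⟩, h⟩ := IsLocalization.surj (natSubmonoid A) x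
  obtain ⟨n, hn, hm⟩ := mem_natSubmonoid.1 m.2
  refine ⟨n, a, hn, ?_⟩
  rw [← h, ← hm, map_natCast, nsmul_eq_mul, mul_comm]

theorem exists_nsmul_eq_of_eq {a b : A}
    (h : algebraMap A (Rationalization A) a = algebraMap A _ b) :
    ∃ n : ℕ, 0 < n ∧ n • a = n • b := by
  obtain ⟨m, hm⟩ := IsLocalization.exists_of_eq (M := natSubmonoid A) h
  obtain ⟨n, hn, hm'⟩ := mem_natSubmonoid.1 m.2
  exact ⟨n, hn, by simpa [hm', nsmul_eq_mul] using hm⟩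

end Rationalization

end Rationalization

section Subring

variable {R S : Type*} [CommRing R] [CommRing S] {f : R →+* S}

theorem IsFGL.of_map (hf : Function.Injective f) {F : ℕ → ℕ → R}
    (h : IsFGL fun i j => f (F i j)) : IsFGL F where
  unit_left j := hf (by simpa [apply_ite f] using h.unit_left j)
  unit_right j := hf (by simpa [apply_ite f] using h.unit_right j)
  comm i j := hf (h.comm i j)
  assoc a b c := hf (by simpa [Fpow_map] using h.assoc a b c)

theorem IsStrictIso.of_map (hf : Function.Injective f) {θ : ℕ → R}
    (h : IsStrictIso fun i => f (θ i)) : IsStrictIso θ :=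
  ⟨hf (by simpa using h.1), hf (by simpa using h.2)⟩

theorem IsTargetOf.of_map (hf : Function.Injective f) {G G' : ℕ → ℕ → R} {θ : ℕ → R}
    (h : IsTargetOf (fun i j => f (G i j)) (fun i => f (θ i)) fun i j => f (G' i j)) :
    IsTargetOf G θ G' := fun a b =>
  hf (by simpa [Fpow_map, θpow_map] using h a b)

end Subring

/-- A chain of `s` composable strict isomorphisms of formal group laws. -/
structure IsFGLChain {A : Type*} [CommRing A] (s : ℕ) (G : ℕ → ℕ → ℕ → A) (θ : ℕ → ℕ → A) :
    Prop where
  isFGL : ∀ t ≤ s, IsFGL (G t)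
  isIso : ∀ t < s, IsStrictIso (θ t) ∧ IsTargetOf (G t) (θ t) (G (t + 1))

theorem IsFGLChain.map {A B : Type*} [CommRing A] [CommRing B] {s : ℕ} {G : ℕ → ℕ → ℕ → A}
    {θ : ℕ → ℕ → A} (h : IsFGLChain s G θ) (f : A →+* B) :
    IsFGLChain s (fun t i j => f (G t i j)) (fun t n => f (θ t n)) where
  isFGL t ht := (h.isFGL t ht).map f
  isIso t ht := ⟨(h.isIso t ht).1.map f, (h.isIso t ht).2.map f⟩

/-- The generators of weight `e` of the ring classifying chains of strict isomorphisms. -/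
def chainGens {A : Type*} (s : ℕ) (G : ℕ → ℕ → ℕ → A) (θ : ℕ → ℕ → A) (e : ℕ) : Set A :=
  {x | ∃ t ≤ s, ∃ i j, i + j = e + 1 ∧ G t i j = x} ∪ {x | ∃ t < s, θ t (e + 1) = x}

theorem finite_chainGens {A : Type*} (s : ℕ) (G : ℕ → ℕ → ℕ → A) (θ : ℕ → ℕ → A) (e : ℕ) :
    (chainGens s G θ e).Finite := by
  refine Set.Finite.union ?_ ?_
  · refine ((range (s + 1) ×ˢ antidiagonal (e + 1)).finite_toSet.image
      fun p => G p.1 p.2.1 p.2.2).subset ?_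
    rintro _ ⟨t, ht, i, j, hij, rfl⟩
    exact ⟨(t, i, j), by simp [hij, ht], rfl⟩
  · refine ((range s).finite_toSet.image fun t => θ t (e + 1)).subset ?_
    rintro _ ⟨t, ht, rfl⟩
    exact ⟨t, by simpa using ht, rfl⟩

/-- The ring `A` classifies chains of `s` composable strict isomorphisms. -/
structure IsUniversalChain (A : Type) [CommRing A] (s : ℕ) (G : ℕ → ℕ → ℕ → A)
    (θ : ℕ → ℕ → A) : Prop extends IsFGLChain s G θ where
  existsUnique : ∀ (R : Type) [CommRing R] (G' : ℕ → ℕ → ℕ → R) (θ' : ℕ → ℕ → R),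
    IsFGLChain s G' θ' → ∃! ψ : A →+* R,
      (∀ t ≤ s, ∀ i j, ψ (G t i j) = G' t i j) ∧ (∀ t < s, ∀ n, ψ (θ t n) = θ' t n)

namespace IsUniversalChain

variable {A R : Type} [CommRing A] [CommRing R] {s : ℕ} {G : ℕ → ℕ → ℕ → A} {θ : ℕ → ℕ → A}

theorem hom_ext (h : IsUniversalChain A s G θ) {f g : A →+* R}
    (hG : ∀ t ≤ s, ∀ i j, f (G t i j) = g (G t i j)) (hθ : ∀ t < s, ∀ n, f (θ t n) = g (θ t n)) :
    f = g :=
  (h.existsUnique R _ _ (h.map g)).unique ⟨hG, hθ⟩ ⟨fun _ _ _ _ => rfl, fun _ _ _ => rfl⟩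

theorem closure_chainGens (h : IsUniversalChain A s G θ) :
    Subring.closure {g | ∃ e > 0, g ∈ chainGens s G θ e} = ⊤ := by
  classical
  set S := Subring.closure {g | ∃ e > 0, g ∈ chainGens s G θ e} with hS
  have hGmem : ∀ t ≤ s, ∀ i j, G t i j ∈ S := by
    intro t ht i j
    rcases Nat.lt_or_ge 1 (i + j) with hij | hij
    · exact Subring.subset_closure
        ⟨i + j - 1, by omega, Or.inl ⟨t, ht, i, j, by omega, rfl⟩⟩
    · rcases Nat.eq_zero_or_pos i with rfl | hi
      · rw [(h.isFGL t ht).unit_left]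
        split_ifs <;> simp
      · obtain rfl : j = 0 := by omega
        rw [(h.isFGL t ht).unit_right]
        split_ifs <;> simp
  have hθmem : ∀ t < s, ∀ n, θ t n ∈ S := by
    intro t ht n
    match n with
    | 0 => rw [(h.isIso t ht).1.1]; exact S.zero_mem
    | 1 => rw [(h.isIso t ht).1.2]; exact S.one_mem
    | n + 2 => exact Subring.subset_closure ⟨n + 1, by omega, Or.inr ⟨t, ht, rfl⟩⟩
  let r : A → S := fun x => if hx : x ∈ S then ⟨x, hx⟩ else 0
  have hr : ∀ x ∈ S, S.subtype (r x) = x := fun x hx => by simp [r, hx]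
  have hinj : Function.Injective S.subtype := S.subtype_injective
  have hrG : ∀ t ≤ s, (fun i j => S.subtype (r (G t i j))) = G t := fun t ht =>
    funext₂ fun i j => hr _ (hGmem t ht i j)
  have hrθ : ∀ t < s, (fun n => S.subtype (r (θ t n))) = θ t := fun t ht =>
    funext fun n => hr _ (hθmem t ht n)
  have hchain : IsFGLChain s (fun t i j => r (G t i j)) (fun t n => r (θ t n)) := by
    refine ⟨fun t ht => .of_map hinj ?_, fun t ht => ⟨.of_map hinj ?_, .of_map hinj ?_⟩⟩
    · rw [hrG t ht]
      exact h.isFGL t ht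
    · rw [hrθ t ht]
      exact (h.isIso t ht).1
    · rw [hrG t ht.le, hrG (t + 1) ht, hrθ t ht]
      exact (h.isIso t ht).2
  obtain ⟨ψ, ⟨hψG, hψθ⟩, -⟩ := h.existsUnique S _ _ hchain
  have hid : S.subtype.comp ψ = RingHom.id A := h.hom_ext
    (fun t ht i j => by simpa [hψG t ht] using hr _ (hGmem t ht i j))
    (fun t ht n => by simpa [hψθ t ht] using hr _ (hθmem t ht n))
  refine eq_top_iff.2 fun x _ => ?_
  rw [← RingHom.id_apply x, ← hid]
  exact (ψ x).2

theorem grading_le_closure (h : IsUniversalChain A s G θ) {𝒜 : ℤ → AddSubgroup A}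
    (h𝒜 : DirectSum.IsInternal 𝒜) (h1 : (1 : A) ∈ 𝒜 0)
    (hmul : ∀ t t' : ℤ, ∀ x ∈ 𝒜 t, ∀ y ∈ 𝒜 t', x * y ∈ 𝒜 (t + t'))
    (hG : ∀ t (i j : ℕ), G t i j ∈ 𝒜 (2 * ((i : ℤ) + j) - 2))
    (hθ : ∀ t (n : ℕ), θ t n ∈ 𝒜 (2 * (n : ℤ) - 2)) (t : ℤ) :
    𝒜 t ≤ AddSubgroup.closure
      {m | ∃ n : ℕ, IsMonomial (chainGens s G θ) n m ∧ 2 * (n : ℤ) = t} := by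
  refine IsMonomial.grading_le_closure h𝒜 h1 hmul ?_ h.closure_chainGens t
  rintro e _ (⟨t, -, i, j, hij, rfl⟩ | ⟨t, -, rfl⟩)
  · have := hG t i j
    rwa [show 2 * ((i : ℤ) + j) - 2 = 2 * (e : ℤ) by omega] at this
  · have := hθ t (e + 1)
    rwa [show 2 * ((e + 1 : ℕ) : ℤ) - 2 = 2 * (e : ℤ) by push_cast; ring] at this

end IsUniversalChain

/-- The homomorphism `d` between classifying rings omits the `i`-th vertex of a chain. -/
structure IsCoface {A B : Type} [CommRing A] [CommRing B] (s i : ℕ) (G : ℕ → ℕ → ℕ → A)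
    (θ : ℕ → ℕ → A) (G' : ℕ → ℕ → ℕ → B) (θ' : ℕ → ℕ → B) (d : A →+* B) : Prop where
  map_G : ∀ t ≤ s, ∀ a b, d (G t a b) = G' (if t < i then t else t + 1) a b
  map_θ : ∀ t < s, ∀ n, d (θ t n) = if t + 1 < i then θ' t n
    else if t + 1 = i then compθ (θ' (t + 1)) (θ' t) n else θ' (t + 1) n

/-- The homomorphism `σ` extends rational chains by the logarithm of their last vertex. -/
structure IsLogExtension {A B : Type} [CommRing A] [CommRing B] (s : ℕ) (G : ℕ → ℕ → ℕ → A)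
    (θ : ℕ → ℕ → A) (G' : ℕ → ℕ → ℕ → B) (θ' : ℕ → ℕ → B) (σ : B →+* Rationalization A) :
    Prop where
  map_G : ∀ t ≤ s, ∀ i j, σ (G' t i j) = algebraMap A _ (G t i j)
  map_G_last : ∀ i j, σ (G' (s + 1) i j) = additiveFGL _ i j
  map_θ : ∀ t < s, ∀ n, σ (θ' t n) = algebraMap A _ (θ t n)

section LogExtension

variable {A B C : Type} [CommRing A] [CommRing B] [CommRing C] {s : ℕ}
  {G : ℕ → ℕ → ℕ → A} {θ : ℕ → ℕ → A} {G' : ℕ → ℕ → ℕ → B} {θ' : ℕ → ℕ → B}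
  {G'' : ℕ → ℕ → ℕ → C} {θ'' : ℕ → ℕ → C}

theorem exists_isLogExtension (hA : IsFGLChain s G θ) (hB : IsUniversalChain B (s + 1) G' θ') :
    ∃ σ, IsLogExtension s G θ G' θ' σ := by
  have hA' := hA.map (algebraMap A (Rationalization A))
  obtain ⟨l, hl, hlG⟩ :=
    (hA'.isFGL s le_rfl).exists_log Rationalization.isUnit_natCast_succ
  obtain ⟨σ, ⟨hσG, hσθ⟩, -⟩ := hB.existsUnique (Rationalization A)
    (fun t => if t ≤ s then fun i j => algebraMap A _ (G t i j) else additiveFGL _)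
    (fun t => if t < s then fun n => algebraMap A _ (θ t n) else l) (by
      refine ⟨fun t _ => ?_, fun t ht => ?_⟩
      · split_ifs with hts
        · exact hA'.isFGL t hts
        · exact isFGL_additiveFGL
      · by_cases hts : t < s
        · simpa only [hts, hts.le, Nat.succ_le_of_lt hts, if_true] using hA'.isIso t hts
        · obtain rfl : t = s := by omega
          simpa using ⟨hl, hlG⟩)
  refine ⟨σ, fun t ht i j => ?_, fun i j => ?_, fun t ht n => ?_⟩
  · rw [hσG t (by omega), if_pos ht]
  · rw [hσG _ le_rfl, if_neg (by omega)]
  · rw [hσθ t (by omega), if_pos ht]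

theorem IsLogExtension.comp_last (hA : IsUniversalChain A s G θ) {σ : B →+* Rationalization A}
    (hσ : IsLogExtension s G θ G' θ' σ) {d : A →+* B} (hd : IsCoface s (s + 1) G θ G' θ' d) :
    σ.comp d = algebraMap A (Rationalization A) := by
  refine hA.hom_ext (fun t ht i j => ?_) fun t ht n => ?_
  · rw [RingHom.comp_apply, hd.map_G t ht, if_pos (by omega), hσ.map_G t ht]
  · rw [RingHom.comp_apply, hd.map_θ t ht, if_pos (by omega), hσ.map_θ t ht]

theorem IsLogExtension.comp_coface (hB : IsUniversalChain B (s + 1) G' θ')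
    {σ : B →+* Rationalization A} (hσ : IsLogExtension s G θ G' θ' σ)
    {τ : C →+* Rationalization B} (hτ : IsLogExtension (s + 1) G' θ' G'' θ'' τ)
    {i : ℕ} (hi : i ≤ s + 1) {d : A →+* B} (hd : IsCoface s i G θ G' θ' d)
    {d' : B →+* C} (hd' : IsCoface (s + 1) i G' θ' G'' θ'' d') :
    τ.comp d' = (Rationalization.map d).comp σ := by
  have hlast : ∀ a b, (Rationalization.map d).comp σ (G' (s + 1) a b) = additiveFGL _ a b := by
    intro a b
    rw [RingHom.comp_apply, hσ.map_G_last, map_additiveFGL]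
  have hG : ∀ t ≤ s + 1, ∀ a b,
      τ.comp d' (G' t a b) = (Rationalization.map d).comp σ (G' t a b) := by
    intro t ht a b
    rcases Nat.lt_or_ge s t with hts | hts
    · obtain rfl : t = s + 1 := by omega
      rw [hlast, RingHom.comp_apply, hd'.map_G _ ht, if_neg (by omega), hτ.map_G_last]
    · rw [RingHom.comp_apply, RingHom.comp_apply, hd'.map_G t ht, hσ.map_G t hts,
        Rationalization.map_algebraMap, hd.map_G t hts, hτ.map_G _ (by split_ifs <;> omega)]
  refine hB.hom_ext hG fun t ht n => ?_
  rcases Nat.lt_or_ge t s with hts | hts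
  · rw [RingHom.comp_apply, RingHom.comp_apply, hd'.map_θ t ht, hσ.map_θ t hts,
      Rationalization.map_algebraMap, hd.map_θ t hts]
    have h₁ := hτ.map_θ t (by omega)
    have h₂ := hτ.map_θ (t + 1) (by omega)
    split_ifs
    · rw [h₁]
    · rw [compθ_map, compθ_map]
      simp only [h₁, h₂]
    · rw [h₂]
  · obtain rfl : t = s := by omega
    have hiso := hB.isIso t ht
    have hlog (f : B →+* Rationalization B)
        (hf : ∀ a b, f (G' (t + 1) a b) = additiveFGL _ a b) :
        IsTargetOf (fun a b => f (G' t a b)) (fun n => f (θ' t n)) (additiveFGL _) := by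
      have := hiso.2.map f
      simpa only [hf] using this
    have h₁ := hlog _ hlast
    have h₂ := hlog (τ.comp d') fun a b => by rw [hG _ le_rfl, hlast]
    simp only [hG t ht.le] at h₂
    exact congrFun (((hB.isFGL t ht.le).map ((Rationalization.map d).comp σ)).log_unique
      Rationalization.isUnit_natCast_succ (hiso.1.map _) h₂ (hiso.1.map _) h₁) n

end LogExtension

theorem cobarDiff_apply (Cb : ℕ → Type*) [∀ s, CommRing (Cb s)]
    (coface : ∀ s : ℕ, ℕ → (Cb s →+* Cb (s + 1))) (s : ℕ) (x : Cb s) :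
    cobarDiff Cb coface s x = ∑ i ∈ range (s + 2), ((-1 : ℤ) ^ i) • coface s i x := by
  simp [cobarDiff, AddMonoidHom.finsetSum_apply]

section Torsion

variable {Cb : ℕ → Type} [∀ s, CommRing (Cb s)] {G : ∀ s : ℕ, ℕ → ℕ → ℕ → Cb s}
  {θ : ∀ s : ℕ, ℕ → ℕ → Cb s} {coface : ∀ s : ℕ, ℕ → (Cb s →+* Cb (s + 1))}

theorem exists_nsmul_mem_range_cobarDiff (hU : ∀ s, IsUniversalChain (Cb s) s (G s) (θ s))
    (hcof : ∀ s, ∀ i ≤ s + 1, IsCoface s i (G s) (θ s) (G (s + 1)) (θ (s + 1)) (coface s i))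
    (s : ℕ) {z : Cb (s + 1)} (hz : cobarDiff Cb coface (s + 1) z = 0) :
    ∃ n : ℕ, 0 < n ∧ n • z ∈ (cobarDiff Cb coface s).range := by
  obtain ⟨σ, hσ⟩ := exists_isLogExtension (hU s).toIsFGLChain (hU (s + 1))
  obtain ⟨τ, hτ⟩ := exists_isLogExtension (hU (s + 1)).toIsFGLChain (hU (s + 2))
  obtain ⟨n, w, hn, hw⟩ := Rationalization.exists_nsmul_eq (σ z)
  have hface : ∀ i ≤ s + 1, n • τ (coface (s + 1) i z) =
      algebraMap _ (Rationalization (Cb (s + 1))) (coface s i w) := by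
    intro i hi
    have := RingHom.congr_fun
      (hσ.comp_coface (hU _) hτ hi (hcof s i hi) (hcof (s + 1) i (by omega))) z
    rw [RingHom.comp_apply, RingHom.comp_apply] at this
    rw [this, ← map_nsmul, hw, Rationalization.map_algebraMap]
  have hlast : τ (coface (s + 1) (s + 2) z) = algebraMap _ _ z :=
    RingHom.congr_fun (hτ.comp_last (hU _) (hcof (s + 1) (s + 2) le_rfl)) z
  have key : algebraMap _ (Rationalization (Cb (s + 1)))
      (cobarDiff Cb coface s w + ((-1 : ℤ) ^ (s + 2)) • n • z) =
      algebraMap (Cb (s + 1)) _ 0 := by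
    have h := congrArg (fun x => n • τ x) hz
    simp only [cobarDiff_apply, map_zero, smul_zero, map_sum, map_zsmul, smul_sum] at h
    rw [sum_range_succ, hlast] at h
    rw [cobarDiff_apply, map_add, map_sum, map_zero, ← h]
    congr 1
    · refine sum_congr rfl fun i hi => ?_
      rw [map_zsmul, ← hface i (by rw [mem_range] at hi; omega), smul_comm]
    · rw [map_zsmul, map_nsmul, smul_comm]
  obtain ⟨m, hm, h⟩ := Rationalization.exists_nsmul_eq_of_eq key
  refine ⟨m * n, Nat.mul_pos hm hn, ?_⟩
  rw [smul_zero, smul_add, ← map_nsmul] at h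
  rcases neg_one_pow_eq_or ℤ (s + 2) with hs | hs
  · refine ⟨-(m • w), ?_⟩
    rw [map_neg, mul_smul, neg_eq_iff_add_eq_zero]
    simpa [hs] using h
  · refine ⟨m • w, ?_⟩
    rw [mul_smul, ← sub_eq_zero]
    simpa [hs, sub_eq_add_neg] using h

theorem exists_nsmul_eq_zero_of_cobarDiff_zero
    (hU : ∀ s, IsUniversalChain (Cb s) s (G s) (θ s))
    (hcof : ∀ s, ∀ i ≤ s + 1, IsCoface s i (G s) (θ s) (G (s + 1)) (θ (s + 1)) (coface s i))
    {q : ℤ} (hq : q ≠ 0) {z : Cb 0} (hz : cobarDiff Cb coface 0 z = 0)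
    (hzq : z ∈ AddSubgroup.closure
      {m | ∃ n : ℕ, IsMonomial (chainGens 0 (G 0) (θ 0)) n m ∧ 2 * (n : ℤ) = 2 * q}) :
    ∃ n : ℕ, 0 < n ∧ n • z = 0 := by
  obtain ⟨σ, hσ⟩ := exists_isLogExtension (hU 0).toIsFGLChain (hU 1)
  have hkill : ∀ e, 0 < e → ∀ x ∈ chainGens 0 (G 0) (θ 0) e, σ.comp (coface 0 0) x = 0 := by
    rintro e he _ (⟨t, ht, i, j, hij, rfl⟩ | ⟨t, ht, -⟩)
    · obtain rfl : t = 0 := by omega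
      have h := (hcof 0 0 (by omega)).map_G 0 le_rfl i j
      rw [if_neg (lt_irrefl 0)] at h
      rw [RingHom.comp_apply, h, hσ.map_G_last, additiveFGL, if_neg (by omega)]
    · exact absurd ht (Nat.not_lt_zero t)
  have h0 : σ.comp (coface 0 0) z = 0 := by
    have hle : AddSubgroup.closure
        {m | ∃ n : ℕ, IsMonomial (chainGens 0 (G 0) (θ 0)) n m ∧ 2 * (n : ℤ) = 2 * q} ≤
        (σ.comp (coface 0 0)).toAddMonoidHom.ker := by
      rw [AddSubgroup.closure_le]
      rintro m ⟨n, hn, hnq⟩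
      exact hn.map_eq_zero hkill (by omega)
    exact hle hzq
  have h1 : σ (coface 0 1 z) = algebraMap _ _ z :=
    RingHom.congr_fun (hσ.comp_last (hU 0) (hcof 0 1 le_rfl)) z
  have heq : coface 0 0 z = coface 0 1 z := by
    rw [cobarDiff_apply] at hz
    simpa [sum_range_succ, ← sub_eq_add_neg, sub_eq_zero] using hz
  rw [RingHom.comp_apply, heq, h1, ← map_zero (algebraMap (Cb 0) (Rationalization (Cb 0)))] at h0
  obtain ⟨n, hn, h⟩ := Rationalization.exists_nsmul_eq_of_eq h0
  exact ⟨n, hn, by simpa only [smul_zero] using h⟩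

end Torsion

theorem stmt_7
    -- the cobar complex of the Hopf algebroid `(MU_*, MU_*MU)`
    (Cb : ℕ → Type) [∀ s, CommRing (Cb s)]
    -- its internal grading, making each `Cb s` a graded ring
    (gr : ∀ s : ℕ, ℤ → AddSubgroup (Cb s))
    (hgr : ∀ s, DirectSum.IsInternal (gr s))
    (hgrone : ∀ s, (1 : Cb s) ∈ gr s 0)
    (hgrmul : ∀ s (t t' : ℤ), ∀ x ∈ gr s t, ∀ y ∈ gr s t', x * y ∈ gr s (t + t'))
    -- the universal chain: `Cb s` carries formal group laws `univGs s 0, …, univGs s s`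
    -- linked by strict isomorphisms `univθ s 0, …, univθ s (s-1)`
    (univGs : ∀ s : ℕ, ℕ → ℕ → ℕ → Cb s)
    (univθ : ∀ s : ℕ, ℕ → ℕ → Cb s)
    (hchainFGL : ∀ s t, t ≤ s → IsFGL (univGs s t))
    (hchain : ∀ s t, t < s → IsStrictIso (univθ s t) ∧
      IsTargetOf (univGs s t) (univθ s t) (univGs s (t + 1)))
    -- `Cb s` corepresents chains of `s` composable strict isomorphisms of FGLs
    -- (for `s = 0` this is exactly Lazard's universality of `Cb 0 = MU_*`)
    (huniv : ∀ (s : ℕ) (R : Type) [CommRing R],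
      ∀ (Gs : ℕ → ℕ → ℕ → R) (θ : ℕ → ℕ → R),
      (∀ t ≤ s, IsFGL (Gs t)) →
      (∀ t < s, IsStrictIso (θ t) ∧ IsTargetOf (Gs t) (θ t) (Gs (t + 1))) →
      ∃! ψ : Cb s →+* R,
        (∀ t ≤ s, ∀ i j, ψ (univGs s t i j) = Gs t i j) ∧
        (∀ t < s, ∀ n, ψ (univθ s t n) = θ t n))
    -- the grading of the universal elements (`|aᵢⱼ| = 2(i+j-1)`, `|bₙ| = 2(n-1)`)
    (hgrG : ∀ s t (i j : ℕ), univGs s t i j ∈ gr s (2 * ((i : ℤ) + j) - 2))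
    (hgrθ : ∀ s t (n : ℕ), univθ s t n ∈ gr s (2 * (n : ℤ) - 2))
    -- the cosimplicial coface ring maps, characterized on the universal chains:
    (coface : ∀ s : ℕ, ℕ → (Cb s →+* Cb (s + 1)))
    (hgrcoface : ∀ s i (t : ℤ), ∀ x ∈ gr s t, coface s i x ∈ gr (s + 1) t)
    -- `d⁰` forgets the first vertex
    (hcof0 : ∀ s, (∀ t ≤ s, ∀ i j,
        coface s 0 (univGs s t i j) = univGs (s + 1) (t + 1) i j) ∧
      (∀ t < s, ∀ n, coface s 0 (univθ s t n) = univθ (s + 1) (t + 1) n))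
    -- `d^{s+1}` forgets the last vertex
    (hcofLast : ∀ s, (∀ t ≤ s, ∀ i j,
        coface s (s + 1) (univGs s t i j) = univGs (s + 1) t i j) ∧
      (∀ t < s, ∀ n, coface s (s + 1) (univθ s t n) = univθ (s + 1) t n))
    -- `dⁱ` (`1 ≤ i ≤ s`) composes the `(i-1)`-st and `i`-th isomorphisms
    (hcofMid : ∀ s i, 1 ≤ i → i ≤ s →
      (∀ t ≤ s, ∀ a b, coface s i (univGs s t a b) =
        (if t < i then univGs (s + 1) t a b else univGs (s + 1) (t + 1) a b)) ∧
      (∀ t, t < s → ∀ n, coface s i (univθ s t n) =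
        (if t < i - 1 then univθ (s + 1) t n
         else if t = i - 1 then compθ (univθ (s + 1) i) (univθ (s + 1) (i - 1)) n
         else univθ (s + 1) (t + 1) n))) :
    -- conclusion: `Ext^{s,2q}` is finite for `(s,q) ≠ (0,0)` and `Ext^{0,0} ≅ ℤ`
    (∀ (s : ℕ) (q : ℤ), ¬(s = 0 ∧ q = 0) →
      Finite (cobarExt Cb coface gr s (2 * q))) ∧
    Nonempty (cobarExt Cb coface gr 0 0 ≃+ ℤ) := by
  have hU (s : ℕ) : IsUniversalChain (Cb s) s (univGs s) (univθ s) :=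
    { isFGL := hchainFGL s
      isIso := hchain s
      existsUnique := fun R _ G θ h => huniv s R G θ h.isFGL h.isIso }
  have hcof (s i : ℕ) (hi : i ≤ s + 1) : IsCoface s i (univGs s) (univθ s) (univGs (s + 1))
      (univθ (s + 1)) (coface s i) := by
    rcases Nat.eq_zero_or_pos i with rfl | hi0
    · exact ⟨fun t ht a b => by simpa using (hcof0 s).1 t ht a b,
        fun t ht n => by simpa using (hcof0 s).2 t ht n⟩
    · rcases Nat.lt_or_ge s i with his | his
      · obtain rfl : i = s + 1 := by omega
        refine ⟨fun t ht a b => ?_, fun t ht n => ?_⟩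
        · rw [(hcofLast s).1 t ht, if_pos (by omega)]
        · rw [(hcofLast s).2 t ht, if_pos (by omega)]
      · refine ⟨fun t ht a b => ?_, fun t ht n => ?_⟩
        · rw [(hcofMid s i hi0 his).1 t ht]
          split_ifs <;> rfl
        · rw [(hcofMid s i hi0 his).2 t ht]
          obtain ⟨k, rfl⟩ : ∃ k, i = k + 1 := ⟨i - 1, by omega⟩
          simp only [Nat.add_sub_cancel, Nat.add_lt_add_iff_right, Nat.add_right_cancel_iff]
          split_ifs with h₁ h₂ <;> first | rfl | rw [h₂]
  have hle (s : ℕ) (t : ℤ) := (hU s).grading_le_closure (hgr s) (hgrone s) (hgrmul s)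
    (hgrG s) (hgrθ s) t
  have hfin (s : ℕ) (t : ℤ) := IsMonomial.finite_of_two_mul
    (finite_chainGens s (univGs s) (univθ s)) t
  refine ⟨fun s q hsq => ?_, ?_⟩
  · refine finite_quotient_of_torsion (hfin s (2 * q)) (inf_le_right.trans (hle s (2 * q))) ?_
    rintro ⟨z, hzker, hzgr⟩
    cases s with
    | zero =>
      obtain ⟨n, hn, h⟩ := exists_nsmul_eq_zero_of_cobarDiff_zero hU hcof
        (by simpa using hsq) hzker (hle 0 (2 * q) hzgr)
      refine ⟨n, hn, ?_⟩
      rw [show n • (⟨z, hzker, hzgr⟩ : ↥((cobarDiff Cb coface 0).ker ⊓ gr 0 (2 * q))) = 0 from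
        Subtype.ext h]
      exact zero_mem _
    | succ s =>
      obtain ⟨n, hn, h⟩ := exists_nsmul_mem_range_cobarDiff hU hcof s hzker
      exact ⟨n, hn, h, (n • (⟨z, hzker, hzgr⟩ :
        ↥((cobarDiff Cb coface (s + 1)).ker ⊓ gr (s + 1) (2 * q)))).2⟩
  · obtain ⟨ε, -⟩ := ((hU 0).existsUnique ℤ (fun _ => additiveFGL ℤ) (fun _ _ => 0)
      ⟨fun _ _ => isFGL_additiveFGL, fun t ht => absurd ht (Nat.not_lt_zero t)⟩).exists
    have hone : (1 : Cb 0) ∈ (cobarDiff Cb coface 0).ker ⊓ gr 0 0 := by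
      refine ⟨?_, hgrone 0⟩
      change cobarDiff Cb coface 0 1 = 0
      rw [cobarDiff_apply]
      simp [sum_range_succ]
    let f : ℤ →+ cobarExt Cb coface gr 0 0 := (QuotientAddGroup.mk' _).comp
      (zmultiplesHom ↥((cobarDiff Cb coface 0).ker ⊓ gr 0 0) ⟨1, hone⟩)
    refine ⟨(AddEquiv.ofBijective f ⟨?_, ?_⟩).symm⟩
    · rw [injective_iff_map_eq_zero]
      intro n hn
      have hmem := (QuotientAddGroup.eq_zero_iff _).1 hn
      have h0 : n • (1 : Cb 0) = 0 := hmem.1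
      simpa using congrArg ε h0
    · intro x
      obtain ⟨⟨z, hzker, hzgr⟩, rfl⟩ := QuotientAddGroup.mk_surjective x
      have hz : z ∈ AddSubgroup.zmultiples (1 : Cb 0) := by
        refine (AddSubgroup.closure_le _).2 ?_ (hle 0 0 hzgr)
        rintro m ⟨n, hn, hn0⟩
        obtain rfl : n = 0 := by omega
        rw [hn.eq_one]
        exact AddSubgroup.mem_zmultiples 1
      obtain ⟨n, rfl⟩ := AddSubgroup.mem_zmultiples_iff.1 hz
      exact ⟨n, rfl⟩
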